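/- Let u₀ be a divergence-free periodic vector field in H^s, s > 5/2, and let T > 0 and M₁ be such that for every Ω > 0 the solution u of the rotating Euler equations with initial data u₀ exists on [0,T] with sup_{0≤t≤T} ‖∇u(·,t)‖_{L∞} ≤ M₁, and suppose M₁T ≤ log(5/4) and Ω ≥ 4M₁. Let ℓ(x,t) = A(x,t) − x and λ(a,t) = X(a,t) − a be the inverse and direct Lagrangian displacements, and ρ = Ω⁻¹ sup_{0≤t≤T} ‖ω(·,t)‖_{L∞} ≤ M₁/Ω (ω = ∇×u). Then for all t ∈ [0,T], ‖∂_z ℓ(·,t)‖_{L∞(dx)} ≤ 14ρ and ‖∂_{a₃} λ(·,t)‖_{L∞(da)} ≤ 9ρ. -/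

import Mathlib

open Real Set MeasureTheory

noncomputable section

/-- The `i`-th standard basis vector of `ℝ³`. -/
def ee (i : Fin 3) : Fin 3 → ℝ := fun j => if j = i then 1 else 0

/-- `det3 u v w` is the determinant of the 3×3 matrix with columns `u`, `v`, `w`. -/
def det3 (u v w : Fin 3 → ℝ) : ℝ :=
  Matrix.det (Matrix.of fun i j => ![u, v, w] j i)

/-- The Levi-Civita symbol `ε_{ijk}`. -/
def lev (i j k : Fin 3) : ℝ := det3 (ee i) (ee j) (ee k)

/-- Cross product in `ℝ³`. -/
def cross (a b : Fin 3 → ℝ) : Fin 3 → ℝ :=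
  ![a 1 * b 2 - a 2 * b 1, a 2 * b 0 - a 0 * b 2, a 0 * b 1 - a 1 * b 0]

/-- Spatial partial derivative `∂ᵢ f (x)` of a scalar function on `ℝ³`. -/
def pd (i : Fin 3) (f : (Fin 3 → ℝ) → ℝ) (x : Fin 3 → ℝ) : ℝ :=
  fderiv ℝ f x (ee i)

/-- A vector field on `ℝ³` is divergence free. -/
def DivFree (v : (Fin 3 → ℝ) → Fin 3 → ℝ) : Prop :=
  ∀ x, ∑ i, pd i (fun y => v y i) x = 0

/-- The curl `∇ × v` of a vector field on `ℝ³`. -/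
def curl (v : (Fin 3 → ℝ) → Fin 3 → ℝ) (x : Fin 3 → ℝ) : Fin 3 → ℝ :=
  ![pd 1 (fun y => v y 2) x - pd 2 (fun y => v y 1) x,
    pd 2 (fun y => v y 0) x - pd 0 (fun y => v y 2) x,
    pd 0 (fun y => v y 1) x - pd 1 (fun y => v y 0) x]

/-- Gradient matrix of a vector field: `grad v x i j = ∂ᵢ vⱼ (x)`. -/
def grad (v : (Fin 3 → ℝ) → Fin 3 → ℝ) (x : Fin 3 → ℝ) : Fin 3 → Fin 3 → ℝ :=
  fun i j => pd i (fun y => v y j) x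

/-- The rotating Euler equations `∂ₜu + (u·∇)u + ∇π + 2Ω e₃ × u = 0` at the point `(x,t)`. -/
def RotEuler (Ω : ℝ) (u : (Fin 3 → ℝ) → ℝ → Fin 3 → ℝ)
    (p : (Fin 3 → ℝ) → ℝ → ℝ) (x : Fin 3 → ℝ) (t : ℝ) : Prop :=
  ∀ i, deriv (fun s => u x s i) t
      + (∑ j, u x t j * pd j (fun y => u y t i) x)
      + pd i (fun y => p y t) x
      + 2 * Ω * cross (ee 2) (u x t) i = 0

/-- `X` is the Lagrangian flow map of the velocity `u`, started at time `t₀`: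
`∂ₜ X(a,t) = u(X(a,t),t)`, `X(a,t₀) = a`. -/
def IsFlowMap (u : (Fin 3 → ℝ) → ℝ → Fin 3 → ℝ)
    (X : (Fin 3 → ℝ) → ℝ → Fin 3 → ℝ) (t₀ : ℝ) : Prop :=
  (∀ a, X a t₀ = a) ∧ ∀ a t, HasDerivAt (fun s => X a s) (u (X a t) t) t

/-- `A` is the back-to-labels map: the inverse of `X(·,t)` for each time `t`. -/
def IsInverseOf (A X : (Fin 3 → ℝ) → ℝ → Fin 3 → ℝ) : Prop :=
  (∀ x t, X (A x t) t = x) ∧ ∀ a t, A (X a t) t = a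

/-- `𝒞(M; w)ᵢ = ½ ε_{ijk} (M_{j·}; M_{k·}; w)`, `M_{j·}` the `j`-th row of `M`. -/
def calC (M : Fin 3 → Fin 3 → ℝ) (w : Fin 3 → ℝ) : Fin 3 → ℝ :=
  fun i => (1/2) * ∑ j, ∑ k, lev i j k * det3 (M j) (M k) w

/-- The periodic box `[0,L₁]×[0,L₂]×[0,L₃]`. -/
def boxSet (L : Fin 3 → ℝ) : Set (Fin 3 → ℝ) := Set.univ.pi fun i => Set.Icc 0 (L i)

/-- Periodicity with periods `L i` in each coordinate direction. -/
def SpacePeriodic (L : Fin 3 → ℝ) (f : (Fin 3 → ℝ) → Fin 3 → ℝ) : Prop :=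
  ∀ (x : Fin 3 → ℝ) (j : Fin 3), f (x + L j • ee j) = f x

/-- Fourier coefficient of a periodic vector field on the box. -/
def fourierCoef (L : Fin 3 → ℝ) (f : (Fin 3 → ℝ) → Fin 3 → ℝ)
    (k : Fin 3 → ℤ) (j : Fin 3) : ℂ :=
  (((L 0) * (L 1) * (L 2) : ℂ))⁻¹ *
    ∫ x in boxSet L,
      Complex.exp (-2 * Real.pi * Complex.I * ∑ i, (k i : ℂ) * (x i : ℂ) / (L i : ℂ))
        * (f x j : ℂ)

/-- The `Hˢ` weight `(1+|k|²)ˢ`. -/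
def hsWeight (s : ℝ) (k : Fin 3 → ℤ) : ℝ := (1 + ∑ i, ((k i : ℝ))^2) ^ s

/-- Membership in `Hˢ`: the weighted series of squared Fourier coefficients is summable. -/
def InHs (s : ℝ) (L : Fin 3 → ℝ) (f : (Fin 3 → ℝ) → Fin 3 → ℝ) : Prop :=
  Summable fun k : Fin 3 → ℤ => hsWeight s k * ∑ j, ‖fourierCoef L f k j‖^2

/-- The `Hˢ` norm `(Σ_k (1+|k|²)ˢ |f̂(k)|²)^{1/2}`. -/
def hsNorm (s : ℝ) (L : Fin 3 → ℝ) (f : (Fin 3 → ℝ) → Fin 3 → ℝ) : ℝ :=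
  Real.sqrt (∑' k : Fin 3 → ℤ, hsWeight s k * ∑ j, ‖fourierCoef L f k j‖^2)

open Topology Filter in
lemma curl_free_of_grad (F : (Fin 3 → ℝ) → Fin 3 → ℝ) (hF : ContDiff ℝ (⊤ : ℕ∞) F)
    (p : (Fin 3 → ℝ) → ℝ) (h : ∀ x i, pd i p x = F x i) (x : Fin 3 → ℝ) (i j : Fin 3) :
    pd j (fun y => F y i) x = pd i (fun y => F y j) x := by
  have hFi : ∀ i, ContDiff ℝ (⊤ : ℕ∞) (fun y => F y i) := fun i => by fun_prop
  have hcont : ∀ i j, Continuous (fun x => pd j (fun y => F y i) x) := by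
    intro i j
    unfold pd
    exact ((hFi i).continuous_fderiv (by simp)).clm_apply continuous_const
  by_contra hne
  have hopen : IsOpen {x | pd j (fun y => F y i) x ≠ pd i (fun y => F y j) x} :=
    isOpen_ne_fun (hcont i j) (hcont j i)
  -- at points where `F ≠ 0` the identity holds
  have key : ∀ x, F x ≠ 0 → pd j (fun y => F y i) x = pd i (fun y => F y j) x := by
    intro x hx
    have hev : ∀ᶠ y in 𝓝 x, F y ≠ 0 := hF.continuous.continuousAt.eventually_ne hx
    let f' : (Fin 3 → ℝ) → ((Fin 3 → ℝ) →L[ℝ] ℝ) := fun y =>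
      ∑ k, F y k • (ContinuousLinearMap.proj (R := ℝ) (φ := fun _ : Fin 3 => ℝ) k)
    have hf' : ∀ᶠ y in 𝓝 x, HasFDerivAt p (f' y) y := by
      filter_upwards [hev] with y hy
      have hd : DifferentiableAt ℝ p y := by
        by_contra hnd
        apply hy
        funext k
        rw [← h y k]
        simp [pd, fderiv_zero_of_not_differentiableAt hnd]
      have : fderiv ℝ p y = f' y := by
        ext v
        have hv : v = ∑ k, v k • ee k := by
          funext l
          simp [ee]
        conv_lhs => rw [hv]
        simp only [map_sum, map_smul, f', sum_apply]
        refine Finset.sum_congr rfl fun k _ => ?_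
        have := h y k
        unfold pd at this
        rw [this]
        simp [mul_comm]
      rw [← this]
      exact hd.hasFDerivAt
    have hf'' : HasFDerivAt f' (∑ k, (fderiv ℝ (fun y => F y k) x).smulRight
        (ContinuousLinearMap.proj (R := ℝ) (φ := fun _ : Fin 3 => ℝ) k)) x := by
      apply HasFDerivAt.fun_sum
      intro k _
      have hk := (((hFi k).differentiable (by simp)) x).hasFDerivAt
      exact HasFDerivAt.smul_const (𝕜 := ℝ) hk
        (ContinuousLinearMap.proj (R := ℝ) (φ := fun _ : Fin 3 => ℝ) k)
    have := second_derivative_symmetric_of_eventually hf' hf'' (ee j) (ee i)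
    simpa [ee, pd] using this
  have hzero : ∀ᶠ y in 𝓝 x, F y = 0 := by
    filter_upwards [hopen.mem_nhds hne] with y hy
    by_contra h0
    exact hy (key y h0)
  apply hne
  have : ∀ k, fderiv ℝ (fun y => F y k) x = 0 := by
    intro k
    have : (fun y => F y k) =ᶠ[𝓝 x] fun _ => (0:ℝ) := by
      filter_upwards [hzero] with y hy
      simp [hy]
    rw [this.fderiv_eq]
    simp
  simp [pd, this]

/-- Directional derivative on space-time. -/
def PP (v : (Fin 3 → ℝ) × ℝ) (f : (Fin 3 → ℝ) × ℝ → ℝ) (q : (Fin 3 → ℝ) × ℝ) : ℝ :=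
  fderiv ℝ f q v

lemma PP_contDiff (v) (f : (Fin 3 → ℝ) × ℝ → ℝ) (hf : ContDiff ℝ (⊤ : ℕ∞) f) :
    ContDiff ℝ (⊤ : ℕ∞) (PP v f) := by
  unfold PP
  exact (hf.fderiv_right (m := ((⊤ : ℕ∞) : WithTop ℕ∞)) (by simp)).clm_apply contDiff_const

lemma PP_comm (v w) (f : (Fin 3 → ℝ) × ℝ → ℝ) (hf : ContDiff ℝ (⊤ : ℕ∞) f) (q) :
    PP v (PP w f) q = PP w (PP v f) q := by
  have hs : IsSymmSndFDerivAt ℝ f q := hf.contDiffAt.isSymmSndFDerivAt (by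
    simp only [minSmoothness_of_isRCLikeNormedField]; exact WithTop.coe_le_coe.2 le_top)
  have hd : DifferentiableAt ℝ (fderiv ℝ f) q :=
    (hf.fderiv_right (m := ((⊤ : ℕ∞) : WithTop ℕ∞)) (by simp)).differentiable (by simp) q
  have e : ∀ v w, PP v (PP w f) q = fderiv ℝ (fderiv ℝ f) q v w := by
    intro v w
    unfold PP
    rw [fderiv_clm_apply hd (by fun_prop)]
    simp
  rw [e, e, hs]

lemma PP_add (v) (f g : (Fin 3 → ℝ) × ℝ → ℝ) (hf : ContDiff ℝ (⊤ : ℕ∞) f)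
    (hg : ContDiff ℝ (⊤ : ℕ∞) g) (q) :
    PP v (fun q => f q + g q) q = PP v f q + PP v g q := by
  unfold PP
  rw [fderiv_fun_add (hf.differentiable (by simp) q) (hg.differentiable (by simp) q)]
  rfl

lemma PP_sub (v) (f g : (Fin 3 → ℝ) × ℝ → ℝ) (hf : ContDiff ℝ (⊤ : ℕ∞) f)
    (hg : ContDiff ℝ (⊤ : ℕ∞) g) (q) :
    PP v (fun q => f q - g q) q = PP v f q - PP v g q := by
  unfold PP
  rw [fderiv_fun_sub (hf.differentiable (by simp) q) (hg.differentiable (by simp) q)]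
  rfl

lemma PP_mul (v) (f g : (Fin 3 → ℝ) × ℝ → ℝ) (hf : ContDiff ℝ (⊤ : ℕ∞) f)
    (hg : ContDiff ℝ (⊤ : ℕ∞) g) (q) :
    PP v (fun q => f q * g q) q = PP v f q * g q + f q * PP v g q := by
  unfold PP
  rw [fderiv_fun_mul (hf.differentiable (by simp) q) (hg.differentiable (by simp) q)]
  simp
  ring

lemma PP_const_mul (v) (c : ℝ) (g : (Fin 3 → ℝ) × ℝ → ℝ)
    (hg : ContDiff ℝ (⊤ : ℕ∞) g) (q) :
    PP v (fun q => c * g q) q = c * PP v g q := by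
  unfold PP
  rw [fderiv_const_mul (hg.differentiable (by simp) q)]
  simp

lemma pd_eq_PP (f : (Fin 3 → ℝ) × ℝ → ℝ) (hf : ContDiff ℝ (⊤ : ℕ∞) f) (i x t) :
    pd i (fun y => f (y, t)) x = PP (ee i, 0) f (x, t) := by
  unfold pd PP
  have h1 : HasFDerivAt (fun y : Fin 3 → ℝ => (y, t))
      (ContinuousLinearMap.inl ℝ (Fin 3 → ℝ) ℝ) x := hasFDerivAt_prodMk_left x t
  have h2 := (hf.differentiable (by simp) (x, t)).hasFDerivAt.comp x h1
  have h3 : fderiv ℝ (fun y => f (y, t)) x = _ := h2.fderiv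
  rw [h3]
  simp

lemma deriv_eq_PP (f : (Fin 3 → ℝ) × ℝ → ℝ) (hf : ContDiff ℝ (⊤ : ℕ∞) f) (x t) :
    deriv (fun s => f (x, s)) t = PP (0, 1) f (x, t) := by
  unfold PP
  have h1 : HasDerivAt (fun s : ℝ => (x, s)) ((0 : Fin 3 → ℝ), (1:ℝ)) t :=
    (hasDerivAt_const t x).prodMk (hasDerivAt_id t)
  exact ((hf.differentiable (by simp) (x, t)).hasFDerivAt.comp_hasDerivAt t h1).deriv

lemma ee_decomp (v : Fin 3 → ℝ) (c : ℝ) :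
    ((v, c) : (Fin 3 → ℝ) × ℝ) = c • ((0 : Fin 3 → ℝ), (1:ℝ)) + ∑ k, v k • (ee k, (0:ℝ)) := by
  ext l
  · simp [Prod.fst_sum, ee]
  · simp [Prod.snd_sum]

lemma PP_decomp (v : Fin 3 → ℝ) (c : ℝ) (f : (Fin 3 → ℝ) × ℝ → ℝ) (q) :
    PP (v, c) f q = c * PP (0, 1) f q + ∑ k, v k * PP (ee k, 0) f q := by
  unfold PP
  conv_lhs => rw [ee_decomp]
  simp only [map_add, map_smul, map_sum, smul_eq_mul]

/-- Absolute vorticity equation, pointwise. -/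
lemma vort_eq (Ω : ℝ) (u : (Fin 3 → ℝ) → ℝ → Fin 3 → ℝ) (p : (Fin 3 → ℝ) → ℝ → ℝ)
    (hu : ContDiff ℝ (⊤ : ℕ∞) (fun q : (Fin 3 → ℝ) × ℝ => u q.1 q.2)) (t : ℝ)
    (hdiv : DivFree (fun y => u y t))
    (heuler : ∀ x : Fin 3 → ℝ, RotEuler Ω u p x t) (x : Fin 3 → ℝ) (i : Fin 3) :
    PP (u x t, 1) (fun q => curl (fun y => u y q.2) q.1 i) (x, t) =
      ∑ j, (curl (fun y => u y t) x j + 2 * Ω * ee 2 j) * pd j (fun y => u y t i) x := by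
  have hui : ∀ i, ContDiff ℝ (⊤ : ℕ∞) (fun q : (Fin 3 → ℝ) × ℝ => u q.1 q.2 i) :=
    fun i => by fun_prop
  have hpd : ∀ i j x t, pd j (fun y => u y t i) x =
      PP (ee j, 0) (fun q : (Fin 3 → ℝ) × ℝ => u q.1 q.2 i) (x, t) :=
    fun i j x t => pd_eq_PP _ (hui i) j x t
  have hdt : ∀ i x t, deriv (fun s => u x s i) t =
      PP (0, 1) (fun q : (Fin 3 → ℝ) × ℝ => u q.1 q.2 i) (x, t) :=
    fun i x t => deriv_eq_PP _ (hui i) x t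
  set U : Fin 3 → (Fin 3 → ℝ) × ℝ → ℝ := fun i q => u q.1 q.2 i with hU
  have hUs : ∀ i, ContDiff ℝ (⊤ : ℕ∞) (U i) := hui
  have hPs : ∀ v i, ContDiff ℝ (⊤ : ℕ∞) (PP v (U i)) := fun v i => PP_contDiff v _ (hUs i)
  have hUv : ∀ i x t, u x t i = U i (x, t) := fun _ _ _ => rfl
  let G : Fin 3 → (Fin 3 → ℝ) × ℝ → ℝ := fun i q =>
    ((PP (0, 1) (U i) q + (U 0 q * PP (ee 0, 0) (U i) q + U 1 q * PP (ee 1, 0) (U i) q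
      + U 2 q * PP (ee 2, 0) (U i) q)) + 2 * Ω * (![fun q => (-1) * U 1 q, U 0, fun q => 0 * U 0 q] i q))
  have hc : ∀ i, ContDiff ℝ (⊤ : ℕ∞)
      ((![fun q => (-1) * U 1 q, U 0, fun q => 0 * U 0 q] : Fin 3 → (Fin 3 → ℝ) × ℝ → ℝ) i) := by
    intro i
    fin_cases i
    · exact contDiff_const.mul (hUs 1)
    · exact hUs 0
    · exact contDiff_const.mul (hUs 0)
  have hG : ∀ i, ContDiff ℝ (⊤ : ℕ∞) (G i) := by
    intro i
    have h1 := hPs (0,1) i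
    have h2 := fun j : Fin 3 => hPs (ee j, 0) i
    have h3 := hc i
    exact (h1.add ((((hUs 0).mul (h2 0)).add ((hUs 1).mul (h2 1))).add ((hUs 2).mul (h2 2)))).add
      (contDiff_const.mul h3)
  have hgr : ∀ x i, pd i (fun y => - p y t) x = G i (x, t) := by
    intro x i
    have h := heuler x i
    have hneg : pd i (fun y => - p y t) x = - pd i (fun y => p y t) x := by
      unfold pd
      rw [fderiv_fun_neg]
      rfl
    rw [hneg]
    simp only [hdt, hpd, Fin.sum_univ_three] at h
    have hcr : cross (ee 2) (u x t) i =
        (![fun q => (-1) * U 1 q, U 0, fun q => 0 * U 0 q] : Fin 3 → (Fin 3 → ℝ) × ℝ → ℝ) i (x, t) := by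
      fin_cases i <;> simp [cross, ee, hU]
    rw [hcr] at h
    simp only [hUv] at h
    simp only [G]
    linarith
  have hFs : ContDiff ℝ (⊤ : ℕ∞) (fun y : Fin 3 → ℝ => fun i => G i (y, t)) := by
    rw [contDiff_pi]
    intro i
    exact (hG i).comp (contDiff_id.prodMk contDiff_const)
  have hcf : ∀ i j, PP (ee j, 0) (G i) (x, t) = PP (ee i, 0) (G j) (x, t) := by
    intro i j
    have := curl_free_of_grad _ hFs _ hgr x i j
    rwa [pd_eq_PP _ (hG i), pd_eq_PP _ (hG j)] at this
  have hPG : ∀ v i, PP v (G i) (x, t) = PP (0,1) (PP v (U i)) (x, t)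
      + ((PP v (U 0) (x,t) * PP (ee 0, 0) (U i) (x,t) + U 0 (x,t) * PP (ee 0, 0) (PP v (U i)) (x,t))
      + (PP v (U 1) (x,t) * PP (ee 1, 0) (U i) (x,t) + U 1 (x,t) * PP (ee 1, 0) (PP v (U i)) (x,t))
      + (PP v (U 2) (x,t) * PP (ee 2, 0) (U i) (x,t) + U 2 (x,t) * PP (ee 2, 0) (PP v (U i)) (x,t)))
      + 2 * Ω * PP v ((![fun q => (-1) * U 1 q, U 0, fun q => 0 * U 0 q] :
          Fin 3 → (Fin 3 → ℝ) × ℝ → ℝ) i) (x,t) := by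
    intro v i
    have h1 := hPs (0,1) i
    have h2 := fun j : Fin 3 => hPs (ee j, 0) i
    have h3 := hc i
    have h4 := fun j => (hUs j).mul (h2 j)
    simp only [G]
    rw [PP_add _ _ _ (h1.add (((h4 0).add (h4 1)).add (h4 2))) (contDiff_const.mul h3),
      PP_add _ _ _ h1 (((h4 0).add (h4 1)).add (h4 2)),
      PP_add _ _ _ ((h4 0).add (h4 1)) (h4 2), PP_add _ _ _ (h4 0) (h4 1),
      PP_mul _ _ _ (hUs 0) (h2 0), PP_mul _ _ _ (hUs 1) (h2 1), PP_mul _ _ _ (hUs 2) (h2 2),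
      PP_const_mul _ _ _ h3, PP_comm v _ _ (hUs i), PP_comm v _ _ (hUs i), PP_comm v _ _ (hUs i),
      PP_comm v _ _ (hUs i)]
  have hd := hdiv x
  simp only [hpd, Fin.sum_univ_three] at hd
  have c0 : ∀ v, PP v ((![fun q => (-1) * U 1 q, U 0, fun q => 0 * U 0 q] :
          Fin 3 → (Fin 3 → ℝ) × ℝ → ℝ) 0) (x,t) = -1 * PP v (U 1) (x,t) :=
    fun v => PP_const_mul v _ _ (hUs 1) _
  have c1 : ∀ v, PP v ((![fun q => (-1) * U 1 q, U 0, fun q => 0 * U 0 q] :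
          Fin 3 → (Fin 3 → ℝ) × ℝ → ℝ) 1) (x,t) = PP v (U 0) (x,t) :=
    fun v => rfl
  have c2 : ∀ v, PP v ((![fun q => (-1) * U 1 q, U 0, fun q => 0 * U 0 q] :
          Fin 3 → (Fin 3 → ℝ) × ℝ → ℝ) 2) (x,t) = 0 * PP v (U 0) (x,t) :=
    fun v => PP_const_mul v _ _ (hUs 0) _
  rw [PP_decomp]
  have hps := fun j k : Fin 3 => hPs (ee j, 0) k
  have e20 : ee 2 0 = 0 := by simp [ee]
  have e21 : ee 2 1 = 0 := by simp [ee]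
  have e22 : ee 2 2 = 1 := by simp [ee]
  have r0 := hcf 2 1
  have r1 := hcf 0 2
  have r2 := hcf 1 0
  simp only [hPG, c0, c1, c2] at r0 r1 r2
  fin_cases i
  · simp only [curl, hpd, Fin.sum_univ_three, e20, e21, e22, Fin.zero_eta, Fin.mk_one, Fin.reduceFinMk, Matrix.cons_val]
    simp only [hUv, PP_sub _ _ _ (hps 1 2) (hps 2 1)]
    norm_num
    linear_combination r0 - (PP (ee 1, 0) (U 2) (x,t) - PP (ee 2, 0) (U 1) (x,t)) * hd
  · simp only [curl, hpd, Fin.sum_univ_three, e20, e21, e22, Fin.zero_eta, Fin.mk_one, Fin.reduceFinMk, Matrix.cons_val]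
    simp only [hUv, PP_sub _ _ _ (hps 2 0) (hps 0 2)]
    norm_num
    linear_combination r1 - (PP (ee 2, 0) (U 0) (x,t) - PP (ee 0, 0) (U 2) (x,t)) * hd
  · simp only [curl, hpd, Fin.sum_univ_three, e20, e21, e22, Fin.zero_eta, Fin.mk_one, Fin.reduceFinMk, Matrix.cons_val]
    simp only [hUv, PP_sub _ _ _ (hps 0 1) (hps 1 0)]
    norm_num
    linear_combination r2 - (PP (ee 0, 0) (U 1) (x,t) - PP (ee 1, 0) (U 0) (x,t) + 2 * Ω) * hd

lemma fderiv_coord (v : (Fin 3 → ℝ) → Fin 3 → ℝ) (hv : Differentiable ℝ v) (x w : Fin 3 → ℝ)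
    (i : Fin 3) : fderiv ℝ v x w i = ∑ j, w j * pd j (fun y => v y i) x := by
  have h1 : HasFDerivAt (fun y => v y i)
      ((ContinuousLinearMap.proj (R := ℝ) (φ := fun _ : Fin 3 => ℝ) i).comp (fderiv ℝ v x)) x :=
    (hasFDerivAt_pi'.1 (hv x).hasFDerivAt) i
  have hw : w = ∑ k, w k • ee k := by
    funext l
    simp [ee]
  unfold pd
  rw [h1.fderiv]
  conv_lhs => rw [hw]
  simp

lemma lip_of_grad (v : (Fin 3 → ℝ) → Fin 3 → ℝ) (hv : Differentiable ℝ v) (M : NNReal)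
    (hM : ∀ x, ‖grad v x‖ ≤ M) : LipschitzWith (3 * M) v := by
  apply lipschitzWith_of_nnnorm_fderiv_le hv
  intro x
  rw [← NNReal.coe_le_coe, coe_nnnorm]
  apply ContinuousLinearMap.opNorm_le_bound _ (by positivity)
  intro w
  rw [pi_norm_le_iff_of_nonneg (by positivity)]
  intro i
  rw [fderiv_coord v hv]
  have hb : ∀ j, ‖w j * pd j (fun y => v y i) x‖ ≤ ‖w‖ * M := by
    intro j
    rw [norm_mul]
    have h1 : ‖grad v x j i‖ ≤ M := (norm_le_pi_norm (grad v x j) i).trans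
      ((norm_le_pi_norm (grad v x) j).trans (hM x))
    exact mul_le_mul (norm_le_pi_norm w j) h1 (norm_nonneg _) (norm_nonneg _)
  calc ‖∑ j, w j * pd j (fun y => v y i) x‖ ≤ ∑ j, ‖w j * pd j (fun y => v y i) x‖ :=
        norm_sum_le _ _
    _ ≤ ∑ _j : Fin 3, ‖w‖ * M := Finset.sum_le_sum fun j _ => hb j
    _ = ((3 * M : NNReal) : ℝ) * ‖w‖ := by simp; ring

open Topology Filter in
lemma tangent_flow (u : (Fin 3 → ℝ) → ℝ → Fin 3 → ℝ)
    (hu : ContDiff ℝ (⊤ : ℕ∞) (fun q : (Fin 3 → ℝ) × ℝ => u q.1 q.2))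
    (X : (Fin 3 → ℝ) → ℝ → Fin 3 → ℝ) (hX : IsFlowMap u X 0) (T : ℝ)
    (K : NNReal) (hK : ∀ t ∈ Icc (0:ℝ) T, LipschitzWith K (fun y => u y t))
    (a : Fin 3 → ℝ) (W : ℝ → Fin 3 → ℝ) (hWc : Continuous W)
    (hW : ∀ s ∈ Icc (0:ℝ) T,
      HasDerivAt W (fun i => ∑ j, W s j * pd j (fun y => u y s i) (X a s)) s)
    (ε : ℝ) (hε : 0 < ε) :
    ∀ᶠ h in 𝓝 (0:ℝ), ∀ t ∈ Icc (0:ℝ) T,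
      ‖X (a + h • W 0) t - X a t - h • W t‖ ≤ ε * |h| := by
  have hXc : ∀ b, Continuous (X b) := fun b =>
    continuous_iff_continuousAt.2 fun t => (hX.2 b t).continuousAt
  set U : (Fin 3 → ℝ) × ℝ → (Fin 3 → ℝ) := fun q => u q.1 q.2 with hU
  let g : ℝ × ℝ → (Fin 3 → ℝ) := fun r =>
    fderiv ℝ U (X a r.2 + r.1 • W r.2, r.2) (W r.2, 0)
  have hgc : Continuous g := by
    have h1 : Continuous (fderiv ℝ U) := hu.continuous_fderiv (by simp)
    have h2 := hXc a
    apply (h1.comp (f := fun r : ℝ × ℝ => (X a r.2 + r.1 • W r.2, r.2)) (by fun_prop)).clm_apply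
    fun_prop
  have hgd : ∀ s h, HasDerivAt (fun h : ℝ => u (X a s + h • W s) s) (g (h, s)) h := by
    intro s h
    have h1 : HasDerivAt (fun h : ℝ => (X a s + h • W s, s)) (W s, (0:ℝ)) h := by
      apply HasDerivAt.prodMk _ (hasDerivAt_const _ _)
      simpa using ((hasDerivAt_id h).smul_const (W s)).const_add (X a s)
    exact (hu.differentiable (by simp) (X a s + h • W s, s)).hasFDerivAt.comp_hasDerivAt h h1
  have hus : ∀ s, Differentiable ℝ (fun y => u y s) := by
    intro s
    exact (hu.comp (contDiff_id.prodMk contDiff_const)).differentiable (by simp)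
  have hg0 : ∀ s, g (0, s) = fun i => ∑ j, W s j * pd j (fun y => u y s i) (X a s) := by
    intro s
    have h1 : HasDerivAt (fun h : ℝ => u (X a s + h • W s) s)
        (fderiv ℝ (fun y => u y s) (X a s) (W s)) 0 := by
      have h2 : HasDerivAt (fun h : ℝ => X a s + h • W s) (W s) 0 := by
        simpa using ((hasDerivAt_id (0:ℝ)).smul_const (W s)).const_add (X a s)
      have h3 : HasFDerivAt (fun y => u y s) (fderiv ℝ (fun y => u y s) (X a s))
          (X a s + (0:ℝ) • W s) := by simpa using (hus s (X a s)).hasFDerivAt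
      exact h3.comp_hasDerivAt 0 h2
    rw [(hgd s 0).unique h1]
    funext i
    exact fderiv_coord _ (hus s) _ _ _
  let K' : NNReal := K + 1
  have hK'1 : (1:ℝ) ≤ K' := by simp [K']
  have hK' : ∀ t ∈ Icc (0:ℝ) T, LipschitzWith K' (fun y => u y t) :=
    fun t ht => (hK t ht).weaken (by simp [K'])
  set η : ℝ := ε / exp (K' * T) with hη
  have hηp : 0 < η := by positivity
  have hopen : IsOpen {r : ℝ × ℝ | ‖g r - g (0, r.2)‖ < η} := by
    apply isOpen_lt _ continuous_const
    have : Continuous fun r : ℝ × ℝ => g (0, r.2) := hgc.comp (by fun_prop)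
    exact (hgc.sub this).norm
  obtain ⟨A, B, hA, hB, hA0, hBT, hAB⟩ := generalized_tube_lemma
    (isCompact_singleton (x := (0:ℝ))) (isCompact_Icc (a := (0:ℝ)) (b := T)) hopen (by
      rintro ⟨h, s⟩ ⟨hh, hs⟩
      simp only [mem_singleton_iff] at hh
      subst hh
      simpa using hηp)
  obtain ⟨δ, hδ, hball⟩ := Metric.isOpen_iff.1 hA 0 (by simpa using hA0)
  filter_upwards [Metric.ball_mem_nhds (0:ℝ) hδ] with h hh
  have happrox : ∀ s ∈ Icc (0:ℝ) T,
      ‖u (X a s + h • W s) s - u (X a s) s - h • g (0, s)‖ ≤ η * |h| := by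
    intro s hs
    have hd : ∀ k ∈ Metric.ball (0:ℝ) δ, HasDerivWithinAt
        (fun k : ℝ => u (X a s + k • W s) s - k • g (0, s)) (g (k, s) - g (0, s))
        (Metric.ball (0:ℝ) δ) k := by
      intro k _
      have h2 : HasDerivAt (fun k : ℝ => k • g (0, s)) (g (0, s)) k := by
        simpa using (hasDerivAt_id k).smul_const (g (0, s))
      exact ((hgd s k).sub h2).hasDerivWithinAt
    have hb : ∀ k ∈ Metric.ball (0:ℝ) δ, ‖g (k, s) - g (0, s)‖ ≤ η := by
      intro k hk
      exact le_of_lt (hAB (show (k, s) ∈ A ×ˢ B from ⟨hball hk, hBT hs⟩))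
    have := (convex_ball (0:ℝ) δ).norm_image_sub_le_of_norm_hasDerivWithin_le hd hb
      (Metric.mem_ball_self hδ) hh
    simp only [zero_smul, add_zero, sub_zero, Real.norm_eq_abs] at this
    have e : u (X a s + h • W s) s - u (X a s) s - h • g (0, s) =
        u (X a s + h • W s) s - h • g (0, s) - u (X a s) s := by abel
    rw [e]
    exact this
  intro t ht
  have hT0 : 0 ≤ T := ht.1.trans ht.2
  have main := dist_le_of_approx_trajectories_ODE_of_mem (v := fun s y => u y s)
    (s := fun _ => univ) (K := K') (a := 0) (b := T) (δ := 0) (εf := 0) (εg := η * |h|)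
    (f := X (a + h • W 0)) (f' := fun s => u (X (a + h • W 0) s) s)
    (g := fun s => X a s + h • W s) (g' := fun s => u (X a s) s + h • g (0, s))
    (fun s hs => (hK' s ⟨hs.1, hs.2.le⟩).lipschitzOnWith)
    (hXc _).continuousOn (fun s _ => (hX.2 _ s).hasDerivWithinAt) (by simp) (by simp)
    (by have := hXc a; fun_prop)
    (fun s hs => by
      have h1 := hW s ⟨hs.1, hs.2.le⟩
      rw [← hg0] at h1
      exact ((hX.2 a s).add (h1.const_smul h)).hasDerivWithinAt)
    (fun s hs => by
      rw [dist_comm, dist_eq_norm]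
      have := happrox s ⟨hs.1, hs.2.le⟩
      rwa [← sub_sub])
    (by simp) (by simp [hX.1]) t ht
  rw [dist_eq_norm, ← sub_sub] at main
  refine main.trans ?_
  rw [gronwallBound_of_K_ne_0 (by positivity)]
  simp only [zero_mul, zero_add, sub_zero]
  have e1 : exp (K' * t) - 1 ≤ exp (K' * T) := by
    have : exp (K' * t) ≤ exp (K' * T) :=
      exp_le_exp.2 (mul_le_mul_of_nonneg_left ht.2 (by positivity))
    linarith
  have e2 : 0 ≤ exp (K' * t) - 1 := by
    have : (0:ℝ) ≤ K' * t := mul_nonneg (by positivity) ht.1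
    linarith [add_one_le_exp ((K':ℝ) * t)]
  calc η * |h| / K' * (exp (K' * t) - 1) ≤ η * |h| * exp (K' * T) := by
        apply mul_le_mul (div_le_self (by positivity) hK'1) e1 e2 (by positivity)
    _ = ε * |h| := by rw [hη]; field_simp

lemma flow_lip (u : (Fin 3 → ℝ) → ℝ → Fin 3 → ℝ)
    (X : (Fin 3 → ℝ) → ℝ → Fin 3 → ℝ) (hX : IsFlowMap u X 0) (T : ℝ)
    (K : NNReal) (hK : ∀ t ∈ Icc (0:ℝ) T, LipschitzWith K (fun y => u y t))
    (a b : Fin 3 → ℝ) (t : ℝ) (ht : t ∈ Icc (0:ℝ) T) :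
    ‖X a t - X b t‖ ≤ ‖a - b‖ * exp (K * t) := by
  have hXc : ∀ b, Continuous (X b) := fun b =>
    continuous_iff_continuousAt.2 fun t => (hX.2 b t).continuousAt
  have main := dist_le_of_trajectories_ODE_of_mem (v := fun s y => u y s)
    (s := fun _ => univ) (K := K) (a := 0) (b := T) (δ := dist a b)
    (f := X a) (g := X b)
    (fun s hs => (hK s ⟨hs.1, hs.2.le⟩).lipschitzOnWith)
    (hXc _).continuousOn (fun s _ => (hX.2 _ s).hasDerivWithinAt) (by simp)
    (hXc _).continuousOn (fun s _ => (hX.2 _ s).hasDerivWithinAt) (by simp)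
    (by simp [hX.1]) t ht
  simpa [dist_eq_norm] using main

lemma flow_inv_lip (u : (Fin 3 → ℝ) → ℝ → Fin 3 → ℝ)
    (X : (Fin 3 → ℝ) → ℝ → Fin 3 → ℝ) (hX : IsFlowMap u X 0) (T : ℝ)
    (K : NNReal) (hK : ∀ t ∈ Icc (0:ℝ) T, LipschitzWith K (fun y => u y t))
    (a b : Fin 3 → ℝ) (t : ℝ) (ht : t ∈ Icc (0:ℝ) T) :
    ‖a - b‖ ≤ ‖X a t - X b t‖ * exp (K * t) := by
  have hXc : ∀ b, Continuous (X b) := fun b =>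
    continuous_iff_continuousAt.2 fun t => (hX.2 b t).continuousAt
  have hd : ∀ b s, HasDerivAt (fun s => X b (t - s)) (-u (X b (t - s)) (t - s)) s := by
    intro b s
    have h1 : HasDerivAt (fun s : ℝ => t - s) (-1) s := by
      simpa using (hasDerivAt_id s).const_sub t
    have := (hX.2 b (t - s)).scomp s h1
    simpa using! this
  have main := dist_le_of_trajectories_ODE_of_mem (v := fun s y => - u y (t - s))
    (s := fun _ => univ) (K := K) (a := 0) (b := t) (δ := dist (X a t) (X b t))
    (f := fun s => X a (t - s)) (g := fun s => X b (t - s))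
    (fun s hs => ((hK (t - s) ⟨by linarith [hs.2], by linarith [hs.1, ht.2]⟩).neg).lipschitzOnWith)
    ((hXc _).comp (by fun_prop)).continuousOn (fun s _ => (hd _ s).hasDerivWithinAt) (by simp)
    ((hXc _).comp (by fun_prop)).continuousOn (fun s _ => (hd _ s).hasDerivWithinAt) (by simp)
    (by simp) t ⟨ht.1, le_rfl⟩
  simpa [dist_eq_norm, hX.1] using main

open Topology Filter in
lemma pd_bound (G : (Fin 3 → ℝ) → Fin 3 → ℝ) (x : Fin 3 → ℝ) (C : ℝ) (hC : 0 ≤ C)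
    (h : ∀ ε > 0, ∀ᶠ h in 𝓝 (0:ℝ), ‖G (x + h • ee 2) - G x - h • ee 2‖ ≤ (C + ε) * |h|) :
    ‖(fun i => pd 2 (fun y => G y i - y i) x : Fin 3 → ℝ)‖ ≤ C := by
  rw [pi_norm_le_iff_of_nonneg hC]
  intro i
  by_cases hd : DifferentiableAt ℝ (fun y => G y i - y i) x
  swap
  · simp [pd, fderiv_zero_of_not_differentiableAt hd, hC]
  apply le_of_forall_pos_le_add
  intro ε hε
  have h2 : HasDerivAt (fun h : ℝ => x + h • ee 2) (ee 2) 0 := by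
    simpa using ((hasDerivAt_id (0:ℝ)).smul_const (ee 2)).const_add x
  have h3 : HasFDerivAt (fun y => G y i - y i) (fderiv ℝ (fun y => G y i - y i) x)
      (x + (0:ℝ) • ee 2) := by simpa using hd.hasFDerivAt
  have h4 := h3.comp_hasDerivAt 0 h2
  refine h4.le_of_lip' (by positivity) ?_
  filter_upwards [h ε hε] with k hk
  have := (norm_le_pi_norm _ i).trans hk
  simp only [Function.comp_apply, zero_smul, add_zero, sub_zero, Real.norm_eq_abs, Pi.sub_apply, Pi.zero_apply,
    Pi.add_apply, Pi.smul_apply] at this ⊢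
  have e : G (x + k • ee 2) i - (x i + k • ee 2 i) - (G x i - x i) =
      G (x + k • ee 2) i - G x i - k • ee 2 i := by ring
  rw [e]
  exact this

lemma curl_contDiff (u : (Fin 3 → ℝ) → ℝ → Fin 3 → ℝ)
    (hu : ContDiff ℝ (⊤ : ℕ∞) (fun q : (Fin 3 → ℝ) × ℝ => u q.1 q.2)) (i : Fin 3) :
    ContDiff ℝ (⊤ : ℕ∞)
      (fun q : (Fin 3 → ℝ) × ℝ => curl (fun y => u y q.2) q.1 i) := by
  have hui : ∀ i, ContDiff ℝ (⊤ : ℕ∞) (fun q : (Fin 3 → ℝ) × ℝ => u q.1 q.2 i) :=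
    fun i => by fun_prop
  have hpd : ∀ i j, ContDiff ℝ (⊤ : ℕ∞)
      (fun q : (Fin 3 → ℝ) × ℝ => pd j (fun y => u y q.2 i) q.1) := by
    intro i j
    have := PP_contDiff (ee j, 0) _ (hui i)
    have e : (fun q : (Fin 3 → ℝ) × ℝ => pd j (fun y => u y q.2 i) q.1) =
        PP (ee j, 0) (fun q : (Fin 3 → ℝ) × ℝ => u q.1 q.2 i) := by
      funext q
      exact pd_eq_PP _ (hui i) j q.1 q.2
    rw [e]
    exact this
  fin_cases i
  · exact (hpd 2 1).sub (hpd 1 2)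
  · exact (hpd 0 2).sub (hpd 2 0)
  · exact (hpd 1 0).sub (hpd 0 1)

lemma curl_le (v : (Fin 3 → ℝ) → Fin 3 → ℝ) (M : ℝ) (x : Fin 3 → ℝ) (hM : ‖grad v x‖ ≤ M) :
    ‖curl v x‖ ≤ 2 * M := by
  have hM0 : 0 ≤ M := (norm_nonneg _).trans hM
  have h1 : ∀ i j, ‖pd j (fun y => v y i) x‖ ≤ M := fun i j =>
    (norm_le_pi_norm (grad v x j) i).trans ((norm_le_pi_norm (grad v x) j).trans hM)
  have h2 : ∀ i j k l, ‖pd j (fun y => v y i) x - pd k (fun y => v y l) x‖ ≤ 2 * M := by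
    intro i j k l
    have := norm_sub_le (pd j (fun y => v y i) x) (pd k (fun y => v y l) x)
    linarith [h1 i j, h1 l k]
  rw [pi_norm_le_iff_of_nonneg (by positivity)]
  intro i
  fin_cases i
  · exact h2 2 1 2 1
  · exact h2 0 2 0 2
  · exact h2 1 0 1 0

/-- Under the uniform bound `sup_{[0,T]} ‖∇u‖_{L^∞} ≤ M₁` with
`M₁ T ≤ log(5/4)` and `Ω ≥ 4M₁`, the inverse and direct Lagrangian displacements
`ℓ = A − x`, `λ = X − a` of the solution of the rotating Euler equations with periodic
`Hˢ` data satisfy `‖∂_z ℓ(·,t)‖_{L^∞} ≤ 14ρ` and `‖∂_{a₃} λ(·,t)‖_{L^∞} ≤ 9ρ`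
on `[0,T]`, where `ρ = Ω⁻¹ sup_{[0,T]} ‖ω‖_{L^∞} ≤ M₁/Ω`. -/
theorem statement17 (L : Fin 3 → ℝ) (hL : ∀ i, 0 < L i) (s : ℝ) (hs : 5/2 < s)
    (u₀ : (Fin 3 → ℝ) → Fin 3 → ℝ)
    (hper₀ : SpacePeriodic L u₀) (hdiv₀ : DivFree u₀) (hHs : InHs s L u₀)
    (T M₁ Ω ρ : ℝ) (hT : 0 < T) (hΩ : 0 < Ω)
    (hMT : M₁ * T ≤ Real.log (5/4)) (hΩ4 : 4 * M₁ ≤ Ω)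
    (u : (Fin 3 → ℝ) → ℝ → Fin 3 → ℝ) (p : (Fin 3 → ℝ) → ℝ → ℝ)
    (X A : (Fin 3 → ℝ) → ℝ → Fin 3 → ℝ)
    (hu : ContDiff ℝ (⊤ : ℕ∞) (fun q : (Fin 3 → ℝ) × ℝ => u q.1 q.2))
    (hu0 : ∀ x, u x 0 = u₀ x)
    (hper : ∀ t ∈ Icc (0:ℝ) T, SpacePeriodic L (fun y => u y t))
    (hdiv : ∀ t, DivFree (fun y => u y t))
    (heuler : ∀ x : Fin 3 → ℝ, ∀ t ∈ Icc (0:ℝ) T, RotEuler Ω u p x t)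
    (hM₁ : ∀ t ∈ Icc (0:ℝ) T, ∀ x : Fin 3 → ℝ, ‖grad (fun y => u y t) x‖ ≤ M₁)
    (hX : IsFlowMap u X 0)
    (hbij : ∀ t, Function.Bijective fun a => X a t)
    (hA : IsInverseOf A X)
    (hρ : ρ = Ω⁻¹ * ⨆ (t : Icc (0:ℝ) T) (x : Fin 3 → ℝ), ‖curl (fun y => u y (t:ℝ)) x‖)
    (hρM : ρ ≤ M₁ / Ω) :
    ∀ t ∈ Icc (0:ℝ) T,
      (∀ x : Fin 3 → ℝ,
        ‖(fun i => pd 2 (fun y => A y t i - y i) x : Fin 3 → ℝ)‖ ≤ 14 * ρ)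
      ∧
      ∀ a : Fin 3 → ℝ,
        ‖(fun i => pd 2 (fun b => X b t i - b i) a : Fin 3 → ℝ)‖ ≤ 9 * ρ := by
  have hM0 : 0 ≤ M₁ := (norm_nonneg _).trans (hM₁ 0 ⟨le_rfl, hT.le⟩ 0)
  lift M₁ to NNReal using hM0 with M hMdef
  have hus : ∀ s, Differentiable ℝ (fun y => u y s) := by
    intro s
    exact (hu.comp (contDiff_id.prodMk contDiff_const)).differentiable (by simp)
  have hK : ∀ t ∈ Icc (0:ℝ) T, LipschitzWith (3 * M) (fun y => u y t) :=
    fun t ht => lip_of_grad _ (hus t) M (hM₁ t ht)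
  -- the vorticity is bounded by `Ω ρ`
  have hcurl : ∀ t ∈ Icc (0:ℝ) T, ∀ x, ‖curl (fun y => u y t) x‖ ≤ Ω * ρ := by
    intro t ht x
    have hin : ∀ t : Icc (0:ℝ) T,
        BddAbove (range fun x : Fin 3 → ℝ => ‖curl (fun y => u y (t:ℝ)) x‖) := by
      intro t
      refine ⟨2 * M, ?_⟩
      rintro _ ⟨x, rfl⟩
      exact curl_le _ _ _ (hM₁ t t.2 x)
    have hout : BddAbove (range fun t : Icc (0:ℝ) T =>
        ⨆ x : Fin 3 → ℝ, ‖curl (fun y => u y (t:ℝ)) x‖) := by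
      refine ⟨2 * M, ?_⟩
      rintro _ ⟨t, rfl⟩
      exact ciSup_le fun x => curl_le _ _ _ (hM₁ t t.2 x)
    have h1 := le_ciSup (hin ⟨t, ht⟩) x
    have h2 := le_ciSup hout ⟨t, ht⟩
    rw [hρ, mul_inv_cancel_left₀ hΩ.ne']
    exact h1.trans h2
  have hρ0 : 0 ≤ ρ := by
    have := (norm_nonneg _).trans (hcurl 0 ⟨le_rfl, hT.le⟩ 0)
    exact nonneg_of_mul_nonneg_right this hΩ
  let W : (Fin 3 → ℝ) → ℝ → (Fin 3 → ℝ) := fun a s i =>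
    curl (fun y => u y s) (X a s) i + 2 * Ω * ee 2 i
  have hXc : ∀ b, Continuous (X b) := fun b =>
    continuous_iff_continuousAt.2 fun t => (hX.2 b t).continuousAt
  have hWc : ∀ a, Continuous (W a) := by
    intro a
    refine continuous_pi fun i => ?_
    have h1 := (curl_contDiff u hu i).continuous.comp ((hXc a).prodMk continuous_id)
    exact h1.add continuous_const
  have hW : ∀ a, ∀ s ∈ Icc (0:ℝ) T,
      HasDerivAt (W a) (fun i => ∑ j, W a s j * pd j (fun y => u y s i) (X a s)) s := by
    intro a s hs
    rw [hasDerivAt_pi]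
    intro i
    have h1 : HasDerivAt (fun s => (X a s, s)) (u (X a s) s, (1:ℝ)) s :=
      (hX.2 a s).prodMk (hasDerivAt_id s)
    have h2 := ((curl_contDiff u hu i).differentiable (by simp)
      (X a s, s)).hasFDerivAt.comp_hasDerivAt (f := fun s => (X a s, s)) s h1
    have h3 := vort_eq Ω u p hu s (hdiv s) (fun x => heuler x s hs) (X a s) i
    unfold PP at h3
    rw [h3] at h2
    exact h2.add_const _
  have htan : ∀ a, ∀ ε > 0, ∀ᶠ h in nhds (0:ℝ), ∀ t ∈ Icc (0:ℝ) T,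
      ‖X (a + h • W a 0) t - X a t - h • W a t‖ ≤ ε * |h| := fun a ε hε =>
    tangent_flow u hu X hX T (3 * M) hK a (W a) (hWc a) (hW a) ε hε
  intro t ht
  have hexp : exp (((3 * M : NNReal) : ℝ) * t) ≤ 2 := by
    have h1 : ((3 * M : NNReal) : ℝ) * t ≤ 3 * Real.log (5/4) := by
      push_cast
      have : (M:ℝ) * t ≤ M * T := mul_le_mul_of_nonneg_left ht.2 M.2
      linarith
    refine (exp_le_exp.2 h1).trans ?_
    have h2 : exp (3 * Real.log (5/4)) = (5/4:ℝ)^3 := by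
      rw [← Real.exp_log (show (0:ℝ) < (5/4)^3 by norm_num), Real.log_pow]
      norm_num
    rw [h2]
    norm_num
  set k : ℝ := 1 / (2 * Ω) with hk
  have hkp : 0 < k := by positivity
  have hk1 : k * (2 * Ω) = 1 := by rw [hk]; field_simp
  have hk2 : k * (Ω * ρ) = ρ / 2 := by rw [hk]; field_simp
  -- `k W = e₃ + k ω`
  have hkW : ∀ a s, k • W a s = ee 2 + k • curl (fun y => u y s) (X a s) := by
    intro a s
    funext i
    simp only [W, Pi.smul_apply, Pi.add_apply, smul_eq_mul]
    linear_combination (ee 2 i) * hk1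
  have hkc : ∀ h : ℝ, ∀ s ∈ Icc (0:ℝ) T, ∀ x,
      ‖h • k • curl (fun y => u y s) x‖ ≤ ρ / 2 * |h| := by
    intro h s hs x
    rw [norm_smul, norm_smul, Real.norm_eq_abs, Real.norm_eq_abs, abs_of_pos hkp]
    have := mul_le_mul_of_nonneg_left (hcurl s hs x) hkp.le
    rw [hk2] at this
    rw [mul_comm]
    exact mul_le_mul_of_nonneg_right this (abs_nonneg _)
  have h0 : (0:ℝ) ∈ Icc (0:ℝ) T := ⟨le_rfl, hT.le⟩
  -- first order expansion with the rescaled vector `k W`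
  have htan' : ∀ a, ∀ ε > 0, ∀ᶠ h in nhds (0:ℝ),
      ‖X (a + h • k • W a 0) t - X a t - h • k • W a t‖ ≤ ε * |h| := by
    intro a ε hε
    have h1 := htan a (ε / k) (by positivity)
    have h2 : Filter.Tendsto (fun h : ℝ => h * k) (nhds 0) (nhds 0) := by
      have : Continuous fun h : ℝ => h * k := by fun_prop
      simpa using this.tendsto 0
    filter_upwards [h2.eventually h1] with h hh
    have h3 := hh t ht
    rw [abs_mul, abs_of_pos hkp] at h3
    rw [smul_smul, smul_smul]
    refine h3.trans (le_of_eq ?_)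
    field_simp
  constructor
  · intro x
    refine (pd_bound (fun y => A y t) x (3/2 * ρ) (by positivity) ?_).trans (by linarith)
    intro ε hε
    have hAlip : ∀ x y, ‖A x t - A y t‖ ≤ 2 * ‖x - y‖ := by
      intro x y
      have h1 := flow_inv_lip u X hX T (3 * M) hK (A x t) (A y t) t ht
      rw [hA.1, hA.1] at h1
      have := mul_le_mul_of_nonneg_left hexp (norm_nonneg (x - y))
      linarith
    filter_upwards [htan' (A x t) (ε / 2) (by positivity)] with h hh
    rw [hA.1] at hh
    set a := A x t with ha
    have hXa : X a t = x := hA.1 x t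
    have b1 : ‖A (x + h • ee 2) t - A (x + h • k • W a t) t‖ ≤ ρ * |h| := by
      refine (hAlip _ _).trans ?_
      rw [hkW]
      have e : x + h • ee 2 - (x + h • (ee 2 + k • curl (fun y => u y t) (X a t))) =
          -(h • k • curl (fun y => u y t) (X a t)) := by
        rw [smul_add]; abel
      rw [e, norm_neg]
      linarith [hkc h t ht (X a t)]
    have b2 : ‖A (x + h • k • W a t) t - (a + h • k • W a 0)‖ ≤ ε * |h| := by
      have h1 := hAlip (x + h • k • W a t) (X (a + h • k • W a 0) t)
      rw [hA.2] at h1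
      have e : x + h • k • W a t - X (a + h • k • W a 0) t =
          -(X (a + h • k • W a 0) t - x - h • k • W a t) := by abel
      rw [e, norm_neg] at h1
      linarith
    have b3 := hkc h 0 h0 (X a 0)
    have e : A (x + h • ee 2) t - a - h • ee 2 =
        (A (x + h • ee 2) t - A (x + h • k • W a t) t) +
        (A (x + h • k • W a t) t - (a + h • k • W a 0)) +
        h • k • curl (fun y => u y 0) (X a 0) := by
      rw [hkW a 0, smul_add]; abel
    rw [e]
    refine (norm_add₃_le).trans ?_
    linarith
  · intro a
    refine (pd_bound (fun y => X y t) a (3/2 * ρ) (by positivity) ?_).trans (by linarith)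
    intro ε hε
    have hXlip : ∀ x y, ‖X x t - X y t‖ ≤ 2 * ‖x - y‖ := by
      intro x y
      have h1 := flow_lip u X hX T (3 * M) hK x y t ht
      have := mul_le_mul_of_nonneg_left hexp (norm_nonneg (x - y))
      linarith
    filter_upwards [htan' a ε hε] with h hh
    have b1 : ‖X (a + h • ee 2) t - X (a + h • k • W a 0) t‖ ≤ ρ * |h| := by
      refine (hXlip _ _).trans ?_
      rw [hkW]
      have e : a + h • ee 2 - (a + h • (ee 2 + k • curl (fun y => u y 0) (X a 0))) =
          -(h • k • curl (fun y => u y 0) (X a 0)) := by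
        rw [smul_add]; abel
      rw [e, norm_neg]
      linarith [hkc h 0 h0 (X a 0)]
    have b3 := hkc h t ht (X a t)
    have e : X (a + h • ee 2) t - X a t - h • ee 2 =
        (X (a + h • ee 2) t - X (a + h • k • W a 0) t) +
        (X (a + h • k • W a 0) t - X a t - h • k • W a t) +
        h • k • curl (fun y => u y t) (X a t) := by
      rw [hkW a t, smul_add]; abel
    rw [e]
    refine (norm_add₃_le).trans ?_
    linarith
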